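/- arXiv:math/0611611 — 4 statements merged into one kernel-verified Lean document; each statement's English description precedes it below -/
import Mathlib

section
/- Let n ≥ 1 be an integer and α ∈ ℝ. Let a, b, c, d be holomorphic functions on the punctured unit disk Δ* such that each of z ↦ zⁿ·a(z), z ↦ zⁿ·b(z), z ↦ zⁿ·c(z), z ↦ zⁿ·d(z) extends to a holomorphic function on the full disk Δ, and such that z ↦ a(z)d(z) − b(z)c(z) extends to a holomorphic function on Δ. Then z ↦ z^{2n+1}·Ω_α(z) extends to a holomorphic function on Δ; that is, Ω_α, which a priori has a pole of order at most 2n+2 at 0, actually has a pole of order at most 2n+1. -/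
/-- The open unit disk `Δ ⊆ ℂ`. -/
def unitDisk : Set ℂ := Metric.ball 0 1

/-- The punctured open unit disk `Δ* = Δ ∖ {0}`. -/
def punctDisk : Set ℂ := Metric.ball 0 1 \ {0}

/-- The Bryant quadratic expression `Ω_α = ∇_α s ∧ ∇_α t` of the frame given
by the functions `a, b, c, d`, for the singular connection
`∇_α = d - Γ_α dz/z` with `Γ_α = diag(α, -α)`. -/
noncomputable def OmegaA (α : ℝ) (a b c d : ℂ → ℂ) (z : ℂ) : ℂ :=
  (deriv a z - (α : ℂ) * a z / z) * (deriv d z + (α : ℂ) * d z / z) -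
    (deriv b z + (α : ℂ) * b z / z) * (deriv c z - (α : ℂ) * c z / z)

lemma isOpen_punctDisk : IsOpen punctDisk :=
  Metric.isOpen_ball.sdiff isClosed_singleton

/-- The product rule for a function agreeing with `z ^ (m + 1) * f z` on the punctured disk. -/
lemma deriv_eq_of_eqOn_pow_mul {m : ℕ} {f g : ℂ → ℂ} (hf : DifferentiableOn ℂ f punctDisk)
    (hg : ∀ z ∈ punctDisk, g z = z ^ (m + 1) * f z) {z : ℂ} (hz : z ∈ punctDisk) :
    deriv g z = ((m : ℂ) + 1) * z ^ m * f z + z ^ (m + 1) * deriv f z := by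
  have hmem := isOpen_punctDisk.mem_nhds hz
  have hprod := (hasDerivAt_pow (m + 1) z).mul (hf.differentiableAt hmem).hasDerivAt
  have hgd := hprod.congr_of_eventuallyEq (Filter.eventually_of_mem hmem hg)
  simpa using hgd.deriv

/-- If `zⁿa, zⁿb, zⁿc, zⁿd` and `ad - bc` extend holomorphically to the disk
and `0 < α < 1`, then `z^{2n+1}·Ω_α` extends holomorphically: `Ω_α` has a pole
of order at most `2n+1` rather than `2n+2`. -/
theorem stmt_7 (n : ℕ) (hn : 1 ≤ n) (α : ℝ) (hα0 : 0 < α) (hα1 : α < 1)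
    (a b c d : ℂ → ℂ)
    (ha : DifferentiableOn ℂ a punctDisk) (hb : DifferentiableOn ℂ b punctDisk)
    (hc : DifferentiableOn ℂ c punctDisk) (hd : DifferentiableOn ℂ d punctDisk)
    (hea : ∃ A : ℂ → ℂ, DifferentiableOn ℂ A unitDisk ∧
      ∀ z ∈ punctDisk, A z = z ^ n * a z)
    (heb : ∃ B : ℂ → ℂ, DifferentiableOn ℂ B unitDisk ∧
      ∀ z ∈ punctDisk, B z = z ^ n * b z)
    (hec : ∃ C : ℂ → ℂ, DifferentiableOn ℂ C unitDisk ∧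
      ∀ z ∈ punctDisk, C z = z ^ n * c z)
    (hed : ∃ D : ℂ → ℂ, DifferentiableOn ℂ D unitDisk ∧
      ∀ z ∈ punctDisk, D z = z ^ n * d z)
    (hdet : ∃ E : ℂ → ℂ, DifferentiableOn ℂ E unitDisk ∧
      ∀ z ∈ punctDisk, E z = a z * d z - b z * c z) :
    ∃ F : ℂ → ℂ, DifferentiableOn ℂ F unitDisk ∧
      ∀ z ∈ punctDisk, F z = z ^ (2 * n + 1) * OmegaA α a b c d z := by
  obtain ⟨A, hA, hAa⟩ := hea
  obtain ⟨B, hB, hBb⟩ := heb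
  obtain ⟨C, hC, hCc⟩ := hec
  obtain ⟨D, hD, hDd⟩ := hed
  obtain ⟨E, hE, hEe⟩ := hdet
  obtain ⟨m, rfl⟩ := Nat.exists_eq_add_of_le' hn
  have hopen : IsOpen unitDisk := Metric.isOpen_ball
  have hA' := hA.deriv hopen
  have hB' := hB.deriv hopen
  have hC' := hC.deriv hopen
  have hD' := hD.deriv hopen
  refine ⟨fun z => z * (deriv A z * deriv D z - deriv B z * deriv C z)
    - (((m : ℂ) + 1 - α) * (deriv A z * D z - B z * deriv C z)
      + ((m : ℂ) + 1 + α) * (A z * deriv D z - deriv B z * C z))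
    + ((m : ℂ) + 1 + α) * ((m : ℂ) + 1 - α) * (z ^ (2 * m + 1) * E z), ?_, ?_⟩
  · fun_prop
  · intro z hz
    have hz0 : z ≠ 0 := hz.2
    simp only [OmegaA, deriv_eq_of_eqOn_pow_mul ha hAa hz, deriv_eq_of_eqOn_pow_mul hb hBb hz,
      deriv_eq_of_eqOn_pow_mul hc hCc hz, deriv_eq_of_eqOn_pow_mul hd hDd hz,
      hAa z hz, hBb z hz, hCc z hz, hDd z hz, hEe z hz]
    field_simp
    ring
end

section
/- Let α ∈ ℝ with 0 < α < 1, and let a, b, c, d be holomorphic functions on the full unit disk Δ (in particular holomorphic at 0) with a(z)d(z) − b(z)c(z) = 1 for all z ∈ Δ. Then z²·Ω_α(z) tends to −α² as z → 0. In particular Ω_α is not identically zero on Δ*: there is no Bryant frame for the singular connection ∇_α whose sections are holomorphic across a puncture with nontrivial weight α. (This is the local form of the lemma that the polar divisor of a meromorphic 𝓑-frame contains the support of the parabolic divisor.) -/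
/-- The product `z * f' z + k * f z` is continuous at the origin for `f` holomorphic there. -/
theorem tendsto_mul_deriv_add_const_mul {f : ℂ → ℂ} (hf : DifferentiableOn ℂ f unitDisk) (k : ℂ) :
    Filter.Tendsto (fun z => z * deriv f z + k * f z) (nhds 0) (nhds (k * f 0)) := by
  have hball : unitDisk ∈ nhds (0 : ℂ) := Metric.ball_mem_nhds 0 one_pos
  have han : AnalyticAt ℂ f 0 := hf.analyticAt hball
  have h : ContinuousAt (fun z => z * deriv f z + k * f z) 0 :=
    (continuousAt_id.mul han.deriv.continuousAt).add (continuousAt_const.mul han.continuousAt)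
  simpa [ContinuousAt] using h

/-- Clearing the poles of `OmegaA`. -/
theorem sq_mul_OmegaA (α : ℝ) (a b c d : ℂ → ℂ) {z : ℂ} (hz : z ≠ 0) :
    z ^ 2 * OmegaA α a b c d z =
      (z * deriv a z + -(α : ℂ) * a z) * (z * deriv d z + (α : ℂ) * d z) -
        (z * deriv b z + (α : ℂ) * b z) * (z * deriv c z + -(α : ℂ) * c z) := by
  unfold OmegaA
  field_simp
  ring

theorem nhdsWithin_punctDisk : nhdsWithin (0 : ℂ) punctDisk = nhdsWithin 0 {0}ᶜ := by
  rw [punctDisk, Set.sdiff_eq, Set.inter_comm]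
  exact nhdsWithin_inter_of_mem' (mem_nhdsWithin_of_mem_nhds (Metric.ball_mem_nhds 0 one_pos))

/-- For a frame holomorphic across the puncture with `ad - bc ≡ 1` and a
nontrivial weight `0 < α < 1`, `z²·Ω_α(z) → -α²` as `z → 0`; in particular
`Ω_α` is not identically zero, so there is no such Bryant frame. -/
theorem stmt_10 (α : ℝ) (hα0 : 0 < α) (hα1 : α < 1) (a b c d : ℂ → ℂ)
    (ha : DifferentiableOn ℂ a unitDisk) (hb : DifferentiableOn ℂ b unitDisk)
    (hc : DifferentiableOn ℂ c unitDisk) (hd : DifferentiableOn ℂ d unitDisk)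
    (hdet : ∀ z ∈ unitDisk, a z * d z - b z * c z = 1) :
    Filter.Tendsto (fun z => z ^ 2 * OmegaA α a b c d z)
        (nhdsWithin 0 punctDisk) (nhds (-(α : ℂ) ^ 2)) ∧
      ∃ z ∈ punctDisk, OmegaA α a b c d z ≠ 0 := by
  have hlim : Filter.Tendsto (fun z => z ^ 2 * OmegaA α a b c d z)
      (nhdsWithin 0 punctDisk) (nhds (-(α : ℂ) ^ 2)) := by
    have h := (((tendsto_mul_deriv_add_const_mul ha (-(α : ℂ))).mul
      (tendsto_mul_deriv_add_const_mul hd (α : ℂ))).sub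
      ((tendsto_mul_deriv_add_const_mul hb (α : ℂ)).mul
      (tendsto_mul_deriv_add_const_mul hc (-(α : ℂ))))).mono_left
      (nhdsWithin_le_nhds (s := punctDisk))
    have h0 : a 0 * d 0 - b 0 * c 0 = 1 := hdet 0 (Metric.mem_ball_self one_pos)
    have hval : -(α : ℂ) * a 0 * (α * d 0) - α * b 0 * (-(α : ℂ) * c 0) = -(α : ℂ) ^ 2 := by
      linear_combination -(α : ℂ) ^ 2 * h0
    rw [hval] at h
    refine h.congr' ?_
    filter_upwards [self_mem_nhdsWithin] with z hz
    exact (sq_mul_OmegaA α a b c d hz.2).symm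
  refine ⟨hlim, ?_⟩
  have : (nhdsWithin (0 : ℂ) punctDisk).NeBot := by
    rw [nhdsWithin_punctDisk]
    infer_instance
  have hne : -(α : ℂ) ^ 2 ≠ 0 := by
    simpa using hα0.ne'
  obtain ⟨z, hz, hzmem⟩ := ((hlim.eventually_ne hne).and self_mem_nhdsWithin).exists
  exact ⟨z, hzmem, right_ne_zero_of_mul hz⟩
end

section
/- Let Ω ⊆ ℂ be a nonempty open connected set, let Θ : Ω → M₂(ℂ) have holomorphic entries, let s : Ω → ℂ² be holomorphic and let g : Ω → ℂ be holomorphic and nonconstant. Define (∇u)(z) = u'(z) + Θ(z)·u(z). If (∇s)(z) ∧ (∇(g·s))(z) = 0 for all z ∈ Ω, then s(z) ∧ (∇s)(z) = 0 for all z ∈ Ω. (Local form of the lemma: if s and t are linearly dependent meromorphic sections, t = g·s with g nonconstant, and ∇s ∧ ∇t ≡ 0, then the line sub-bundle generated by s is parallel, so the connection is reducible; hence for an irreducible SU(2) connection, s ∧ t = 0 forces ∇s ∧ ∇t ≠ 0.) -/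
open Matrix

/-- The flat holomorphic connection `∇u = u' + Θ·u` in a local trivialization. -/
noncomputable def nablaOp (Θ : ℂ → Matrix (Fin 2) (Fin 2) ℂ)
    (u : ℂ → Fin 2 → ℂ) (z : ℂ) : Fin 2 → ℂ :=
  deriv u z + Θ z *ᵥ u z

/-- The determinant pairing `u ∧ v = u₀v₁ - u₁v₀` on `ℂ²`. -/
def wedge2 (u v : Fin 2 → ℂ) : ℂ := u 0 * v 1 - u 1 * v 0

theorem wedge2_nablaOp_smul (Θ : ℂ → Matrix (Fin 2) (Fin 2) ℂ) {s : ℂ → Fin 2 → ℂ} {g : ℂ → ℂ}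
    {z : ℂ} (hs : DifferentiableAt ℂ s z) (hg : DifferentiableAt ℂ g z) :
    wedge2 (nablaOp Θ s z) (nablaOp Θ (fun ζ => g ζ • s ζ) z) =
      -(deriv g z * wedge2 (s z) (nablaOp Θ s z)) := by
  have hd : deriv (fun ζ => g ζ • s ζ) z = g z • deriv s z + deriv g z • s z :=
    (hg.hasDerivAt.smul hs.hasDerivAt).deriv
  simp only [wedge2, nablaOp, hd, Matrix.mulVec_smul, Pi.add_apply, Pi.smul_apply, smul_eq_mul]
  ring

theorem continuousOn_wedge2_nablaOp {Ω : Set ℂ} (hΩ : IsOpen Ω)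
    {Θ : ℂ → Matrix (Fin 2) (Fin 2) ℂ}
    (hΘ : ∀ i j, DifferentiableOn ℂ (fun z => Θ z i j) Ω)
    {s : ℂ → Fin 2 → ℂ} (hs : DifferentiableOn ℂ s Ω) :
    ContinuousOn (fun z => wedge2 (s z) (nablaOp Θ s z)) Ω := by
  have hsc (i : Fin 2) : ContinuousOn (fun z => s z i) Ω := continuousOn_pi.1 hs.continuousOn i
  have hdc (i : Fin 2) : ContinuousOn (fun z => deriv s z i) Ω :=
    continuousOn_pi.1 (hs.deriv hΩ).continuousOn i
  have hn (i : Fin 2) : ContinuousOn (fun z => nablaOp Θ s z i) Ω := by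
    simp only [nablaOp, Pi.add_apply, Matrix.mulVec, dotProduct]
    exact (hdc i).add
      (continuousOn_finsetSum _ fun j _ => (hΘ i j).continuousOn.mul (hsc j))
  exact ((hsc 0).mul (hn 1)).sub ((hsc 1).mul (hn 0))

/-- If `g` is a nonconstant holomorphic function and `∇s ∧ ∇(g·s) ≡ 0`, then
`s ∧ ∇s ≡ 0`, i.e. the line bundle generated by `s` is parallel. -/
theorem stmt_12 (Ω : Set ℂ) (hΩopen : IsOpen Ω) (hΩconn : IsConnected Ω)
    (Θ : ℂ → Matrix (Fin 2) (Fin 2) ℂ)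
    (hΘ : ∀ i j, DifferentiableOn ℂ (fun z => Θ z i j) Ω)
    (s : ℂ → Fin 2 → ℂ) (hs : DifferentiableOn ℂ s Ω)
    (g : ℂ → ℂ) (hg : DifferentiableOn ℂ g Ω)
    (hgnc : ¬ ∃ c : ℂ, ∀ z ∈ Ω, g z = c)
    (h : ∀ z ∈ Ω, wedge2 (nablaOp Θ s z) (nablaOp Θ (fun ζ => g ζ • s ζ) z) = 0) :
    ∀ z ∈ Ω, wedge2 (s z) (nablaOp Θ s z) = 0 := by
  intro z₀ hz₀
  by_contra hne
  have hev : deriv g =ᶠ[nhds z₀] 0 := by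
    have hnear : Ω ∈ nhds z₀ := hΩopen.mem_nhds hz₀
    filter_upwards [hnear,
      ((continuousOn_wedge2_nablaOp hΩopen hΘ hs).continuousAt hnear).eventually_ne hne]
      with z hz hwz
    have hzero := h z hz
    rw [wedge2_nablaOp_smul Θ (hs.differentiableAt (hΩopen.mem_nhds hz))
      (hg.differentiableAt (hΩopen.mem_nhds hz)), neg_eq_zero] at hzero
    exact (mul_eq_zero.1 hzero).resolve_right hwz
  have hderiv : Set.EqOn (deriv g) 0 Ω :=
    ((hg.deriv hΩopen).analyticOnNhd hΩopen).eqOn_of_preconnected_of_eventuallyEq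
      (fun _ _ => analyticAt_const) hΩconn.isPreconnected hz₀ hev
  exact hgnc ⟨g z₀, fun z hz =>
    hΩopen.is_const_of_deriv_eq_zero hΩconn.isPreconnected hg hderiv hz hz₀⟩
end

section
/- Let U ⊆ ℂ be open, let A : U → M₂(ℂ) have holomorphic entries with det A(z) = 1 for all z ∈ U and det A'(z) = 0 for all z ∈ U (the Bryant condition), and let z₀ ∈ U. Consider the ℝ-linear map L : ℂ → M₂(ℂ) given by L(w) = w·A'(z₀)·A(z₀)* + conj(w)·A(z₀)·(A'(z₀))*, which is the differential at z₀ of the map f(z) = A(z)·A(z)*. Then L is injective if and only if A'(z₀) ≠ 0. (Hence the associated cmc-1 map f is an immersion at exactly the points where the local holomorphic lifting A has nonvanishing derivative; the branch points of f are the zeros of A'.) -/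
open Matrix

/-- The entrywise complex derivative of a matrix-valued map. -/
noncomputable def matDeriv (A : ℂ → Matrix (Fin 2) (Fin 2) ℂ)
    (z : ℂ) : Matrix (Fin 2) (Fin 2) ℂ :=
  Matrix.of fun i j => deriv (fun w => A w i j) z

theorem Matrix.mul_self_eq_zero_of_trace_of_det {R : Type*} [CommRing R]
    {N : Matrix (Fin 2) (Fin 2) R} (htr : N.trace = 0) (hdet : N.det = 0) : N * N = 0 := by
  rw [trace_fin_two] at htr
  rw [det_fin_two] at hdet
  ext i j
  fin_cases i <;> fin_cases j <;> simp [Matrix.mul_apply, Fin.sum_univ_two] <;> grind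

open scoped ComplexOrder in
theorem Matrix.eq_zero_of_conjTranspose_eq_neg {M : Matrix (Fin 2) (Fin 2) ℂ}
    (hM : Mᴴ = -M) (hsq : M * M = 0) : M = 0 := by
  rw [← self_mul_conjTranspose_eq_zero, hM, mul_neg, hsq, neg_zero]

/-- Jacobi's formula for a holomorphic map with constant determinant `1`. -/
theorem trace_adjugate_mul_matDeriv {U : Set ℂ} (hU : IsOpen U)
    {A : ℂ → Matrix (Fin 2) (Fin 2) ℂ}
    (hA : ∀ i j, DifferentiableOn ℂ (fun z => A z i j) U)
    (hdet : ∀ z ∈ U, (A z).det = 1) {z : ℂ} (hz : z ∈ U) :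
    ((A z).adjugate * matDeriv A z).trace = 0 := by
  have h (i j) : HasDerivAt (fun w => A w i j) (matDeriv A z i j) z :=
    ((hA i j).differentiableAt (hU.mem_nhds hz)).hasDerivAt
  have hd := ((h 0 0).fun_mul (h 1 1)).fun_sub ((h 0 1).fun_mul (h 1 0))
  have hc : (fun w => A w 0 0 * A w 1 1 - A w 0 1 * A w 1 0) =ᶠ[nhds z] fun _ => 1 := by
    filter_upwards [hU.mem_nhds hz] with w hw
    rw [← det_fin_two, hdet w hw]
  have h0 := hd.unique ((hasDerivAt_const z (1 : ℂ)).congr_of_eventuallyEq hc)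
  simp only [trace_fin_two, adjugate_fin_two, Matrix.mul_apply, Fin.sum_univ_two, of_apply,
    cons_val', cons_val_zero, cons_val_one, cons_val_fin_one]
  linear_combination h0

/-- The differential of `g ↦ g gᴴ` at `A ∈ SL(2, ℂ)` kills no nonzero `B` with `A⁻¹ B` nilpotent. -/
theorem eq_zero_of_mul_conjTranspose_add_eq_zero {A B : Matrix (Fin 2) (Fin 2) ℂ}
    (hA : A.det = 1) (htr : (A.adjugate * B).trace = 0) (hB : B.det = 0)
    (h : B * Aᴴ + A * Bᴴ = 0) : B = 0 := by
  have hl : A.adjugate * A = 1 := by rw [adjugate_mul, hA, one_smul]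
  have hr : A * A.adjugate = 1 := by rw [mul_adjugate, hA, one_smul]
  have hl' : Aᴴ * A.adjugateᴴ = 1 := by rw [← conjTranspose_mul, hl, conjTranspose_one]
  have hskew : (A.adjugate * B)ᴴ = -(A.adjugate * B) := by
    rw [conjTranspose_mul, eq_neg_iff_add_eq_zero]
    calc Bᴴ * A.adjugateᴴ + A.adjugate * B
        = (A.adjugate * A) * Bᴴ * A.adjugateᴴ + A.adjugate * B * (Aᴴ * A.adjugateᴴ) := by
          rw [hl, hl', one_mul, mul_one]
      _ = A.adjugate * (B * Aᴴ + A * Bᴴ) * A.adjugateᴴ := by noncomm_ring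
      _ = 0 := by rw [h, mul_zero, zero_mul]
  have h0 := eq_zero_of_conjTranspose_eq_neg hskew
    (mul_self_eq_zero_of_trace_of_det htr (by rw [det_mul, hB, mul_zero]))
  rw [← one_mul B, ← hr, mul_assoc, h0, mul_zero]

/-- For a Bryant (null-holomorphic) map `A` into `SL(2, ℂ)`, the real
differential `L(w) = w·A'(z₀)·A(z₀)* + conj(w)·A(z₀)·A'(z₀)*` of
`f(z) = A(z)·A(z)*` at `z₀` is injective iff `A'(z₀) ≠ 0`. -/
theorem stmt_16 (U : Set ℂ) (hUopen : IsOpen U)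
    (A : ℂ → Matrix (Fin 2) (Fin 2) ℂ)
    (hA : ∀ i j, DifferentiableOn ℂ (fun z => A z i j) U)
    (hdet : ∀ z ∈ U, (A z).det = 1)
    (hbry : ∀ z ∈ U, (matDeriv A z).det = 0)
    (z₀ : ℂ) (hz₀ : z₀ ∈ U) :
    (Function.Injective fun w : ℂ =>
        w • (matDeriv A z₀ * (A z₀)ᴴ) +
          (starRingEnd ℂ) w • (A z₀ * (matDeriv A z₀)ᴴ)) ↔
      matDeriv A z₀ ≠ 0 := by
  constructor
  · intro hinj h0
    exact zero_ne_one (hinj (a₁ := 0) (a₂ := 1) (by simp [h0]))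
  · intro hne w₁ w₂ hw
    by_contra hw'
    have hsub : w₁ - w₂ ≠ 0 := sub_ne_zero.mpr hw'
    have hz : (w₁ - w₂) • matDeriv A z₀ = 0 := by
      refine eq_zero_of_mul_conjTranspose_add_eq_zero (hdet z₀ hz₀) ?_ ?_ ?_
      · rw [Matrix.mul_smul, trace_smul, trace_adjugate_mul_matDeriv hUopen hA hdet hz₀, smul_zero]
      · rw [det_smul, hbry z₀ hz₀, mul_zero]
      · rw [conjTranspose_smul, Matrix.smul_mul, Matrix.mul_smul, ← starRingEnd_apply, map_sub,
          sub_smul, sub_smul, ← add_sub_add_comm]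
        exact sub_eq_zero.mpr hw
    exact smul_ne_zero hsub hne hz
end
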